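/- (Theorem 1, recursive feasibility and robust constraint satisfaction) Assume the zero input increment is admissible, i.e., C_Δu · 0 ≤ g_Δu, and that H(t+1) − H(t) ∈ D and H(t) ∈ Ω for all t, and that θ̲_j(k) ≤ φ(k)ᵀx ≤ θ̄_j(k) for every x with K_j x ≤ l_j. Suppose the FHOCP is feasible at time t = 1 (with given previous input u(0) and regressor φ(1)). Then there exists a closed-loop input sequence {u(t)}_{t≥1} such that for every t ≥ 1: u(t) is the first element of a sequence feasible for the FHOCP at time t (in particular the FHOCP is feasible at every time t ≥ 1), the regressor evolves as φ(t+1) = Fφ(t) + Gu(t), the input constraints C_u u(t) ≤ g_u and C_Δu (u(t) − u(t−1)) ≤ g_Δu hold, and the realized output y(t+1) := H(t+1)φ(t+1) + d(t+1) satisfies the output constraints C_y y(t+1) ≤ g_y. -/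

import Mathlib

open Matrix

/-- The inflated slab `S_i(k)` generated by the measurement at time `i`. -/
def Sset {ny m : ℕ} (φ : ℕ → Fin m → ℝ) (ytil : ℕ → Fin ny → ℝ)
    (εd εv : Fin ny → ℝ) (θlo θhi : Fin ny → ℕ → ℝ) (i k : ℕ) :
    Set (Matrix (Fin ny) (Fin m) ℝ) :=
  {Hm | ∀ j, -(εd j) - εv j + ((k : ℝ) - (i : ℝ)) * θlo j i ≤ Hm j ⬝ᵥ φ i - ytil i j ∧
        Hm j ⬝ᵥ φ i - ytil i j ≤ εd j + εv j + ((k : ℝ) - (i : ℝ)) * θhi j i}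

/-- The prior polytopic uncertainty set `Ω`. -/
def OmegaSet {ny m : ℕ} {r0 : Fin ny → ℕ}
    (A0 : ∀ j, Matrix (Fin (r0 j)) (Fin m) ℝ) (b0 : ∀ j, Fin (r0 j) → ℝ) :
    Set (Matrix (Fin ny) (Fin m) ℝ) :=
  {Hm | ∀ j i, ((A0 j).mulVec (Hm j)) i ≤ b0 j i}

/-- The retained-measurement window `W(k,t) = {i : 1 ≤ i ≤ t, k − i < M/2}`. -/
def Wwin (M k t : ℕ) : Set ℕ := {i | 1 ≤ i ∧ i ≤ t ∧ k - i < M / 2}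

/-- The predicted feasible parameter set `F(k|t)`: equal to `Ω` at the end of the horizon
(`k = t + N`), and to `Ω ∩ ⋂_{i ∈ W(k,t)} S_i(k)` for `t+1 ≤ k ≤ t+N−1`. -/
def Fpred {ny m : ℕ} {r0 : Fin ny → ℕ}
    (A0 : ∀ j, Matrix (Fin (r0 j)) (Fin m) ℝ) (b0 : ∀ j, Fin (r0 j) → ℝ)
    (φ : ℕ → Fin m → ℝ) (ytil : ℕ → Fin ny → ℝ)
    (εd εv : Fin ny → ℝ) (θlo θhi : Fin ny → ℕ → ℝ)
    (M N k t : ℕ) : Set (Matrix (Fin ny) (Fin m) ℝ) :=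
  if k = t + N then OmegaSet A0 b0
  else OmegaSet A0 b0 ∩ ⋂ i ∈ Wwin M k t, Sset φ ytil εd εv θlo θhi i k

/-- `predReg Fm G φt useq t s` is the predicted regressor `φ(t+s|t)` obtained from the
current regressor `φt` and the planned input sequence `useq`, via
`φ(t|t) = φt` and `φ(k+1|t) = F φ(k|t) + G u(k|t)`. -/
noncomputable def predReg {m nu : ℕ} (Fm : Matrix (Fin m) (Fin m) ℝ)
    (G : Matrix (Fin m) (Fin nu) ℝ) (φt : Fin m → ℝ)
    (useq : ℕ → Fin nu → ℝ) (t : ℕ) : ℕ → Fin m → ℝ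
  | 0 => φt
  | s + 1 => Fm.mulVec (predReg Fm G φt useq t s) + G.mulVec (useq (t + s))

/-- Feasibility of the input sequence `useq` (indexed by absolute times `t,…,t+N−1`) for the
FHOCP at time `t`, given the previous input `uprev`, the current regressor `φt` and the
predicted feasible parameter sets `Fset k t = F(k|t)`:
(i) input and input-rate constraints on `[t, t+N−1]`;
(ii) robust output constraints `C_y H φ(k|t) + d̄ ≤ g_y` for all `H ∈ F(k|t)`, `k ∈ [t+1, t+N]`;
(iii) terminal equality constraint `φ(t+N|t) = F φ(t+N|t) + G u(t+N−1|t)`. -/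
def Feasible {ny m nu ni nDu no : ℕ} (N : ℕ)
    (Fm : Matrix (Fin m) (Fin m) ℝ) (G : Matrix (Fin m) (Fin nu) ℝ)
    (Cu : Matrix (Fin ni) (Fin nu) ℝ) (CDu : Matrix (Fin nDu) (Fin nu) ℝ)
    (Cy : Matrix (Fin no) (Fin ny) ℝ)
    (gu : Fin ni → ℝ) (gDu : Fin nDu → ℝ) (gy : Fin no → ℝ)
    (dbar : Fin no → ℝ)
    (Fset : ℕ → ℕ → Set (Matrix (Fin ny) (Fin m) ℝ))
    (t : ℕ) (uprev : Fin nu → ℝ) (φt : Fin m → ℝ)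
    (useq : ℕ → Fin nu → ℝ) : Prop :=
  (∀ k, t ≤ k → k ≤ t + N - 1 →
      (∀ i, (Cu.mulVec (useq k)) i ≤ gu i) ∧
      (∀ i, (CDu.mulVec (useq k - if k = t then uprev else useq (k - 1))) i ≤ gDu i)) ∧
  (∀ k, t + 1 ≤ k → k ≤ t + N → ∀ Hm ∈ Fset k t, ∀ l,
      (Cy.mulVec (Hm.mulVec (predReg Fm G φt useq t (k - t)))) l + dbar l ≤ gy l) ∧
  predReg Fm G φt useq t N =
    Fm.mulVec (predReg Fm G φt useq t N) + G.mulVec (useq (t + N - 1))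

/-- Predicting from a point of a trajectory with the same inputs stays on that trajectory. -/
lemma predReg_shift {m nu : ℕ} (Fm : Matrix (Fin m) (Fin m) ℝ)
    (G : Matrix (Fin m) (Fin nu) ℝ) (x : Fin m → ℝ) (u : ℕ → Fin nu → ℝ) (t r s : ℕ) :
    predReg Fm G (predReg Fm G x u t r) u (t + r) s = predReg Fm G x u t (r + s) := by
  induction s with
  | zero => rfl
  | succ s ih =>
    rw [predReg, ih, ← add_assoc, predReg, add_assoc]

/-- If the plan reaches a steady state after `N` steps and its last input is held from then on,
the regressor stays at that steady state. -/
lemma predReg_hold {m nu : ℕ} (Fm : Matrix (Fin m) (Fin m) ℝ)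
    (G : Matrix (Fin m) (Fin nu) ℝ) (x : Fin m → ℝ) (u w : ℕ → Fin nu → ℝ) (t N : ℕ)
    (hw : ∀ s, w (t + s) = u (min (t + s) (t + N - 1)))
    (hterm : predReg Fm G x u t N = Fm.mulVec (predReg Fm G x u t N) + G.mulVec (u (t + N - 1)))
    (s : ℕ) : predReg Fm G x w t s = predReg Fm G x u t (min s N) := by
  induction s with
  | zero => simp [predReg]
  | succ s ih =>
    rw [predReg, ih, hw]
    rcases lt_or_ge s N with h | h
    · rw [min_eq_left h.le, min_eq_left (by omega : s + 1 ≤ N),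
        min_eq_left (by omega : t + s ≤ t + N - 1), predReg]
    · rw [min_eq_right h, min_eq_right (by omega : N ≤ s + 1),
        min_eq_right (by omega : t + N - 1 ≤ t + s), ← hterm]

/-- A drift whose increments all lie in `[lo, hi]` lies in `[n * lo, n * hi]` after `n` steps. -/
lemma drift_bounds {f : ℕ → ℝ} {lo hi : ℝ}
    (h : ∀ t, lo ≤ f (t + 1) - f t ∧ f (t + 1) - f t ≤ hi) (i n : ℕ) :
    n * lo ≤ f (i + n) - f i ∧ f (i + n) - f i ≤ n * hi := by
  induction n with
  | zero => simp
  | succ n ih =>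
    have := h (i + n)
    rw [← add_assoc]
    push_cast
    constructor <;> linarith [ih.1, ih.2, this.1, this.2]

/-- The true parameter belongs to every slab generated by an earlier measurement. -/
lemma mem_Sset_of_bounds {ny m : ℕ} {H : ℕ → Matrix (Fin ny) (Fin m) ℝ}
    {φ : ℕ → Fin m → ℝ} {d v : ℕ → Fin ny → ℝ} {εd εv : Fin ny → ℝ}
    {θlo θhi : Fin ny → ℕ → ℝ} {i k : ℕ} (hik : i ≤ k)
    (hd : ∀ j, |d i j| ≤ εd j) (hv : ∀ j, |v i j| ≤ εv j)
    (hθ : ∀ t j, θlo j i ≤ φ i ⬝ᵥ (H (t + 1) j - H t j) ∧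
      φ i ⬝ᵥ (H (t + 1) j - H t j) ≤ θhi j i) :
    H k ∈ Sset φ (fun i => (H i).mulVec (φ i) + d i + v i) εd εv θlo θhi i k := by
  intro j
  obtain ⟨n, rfl⟩ := Nat.exists_eq_add_of_le hik
  have hdrift := drift_bounds (f := fun t => H t j ⬝ᵥ φ i) (lo := θlo j i) (hi := θhi j i)
    (fun t => by simpa only [dotProduct_comm (φ i), sub_dotProduct] using hθ t j) i n
  have hd' := abs_le.mp (hd j)
  have hv' := abs_le.mp (hv j)
  have hy : ((H i).mulVec (φ i) + d i + v i) j = H i j ⬝ᵥ φ i + d i j + v i j := rfl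
  simp only [hy]
  push_cast
  rw [add_sub_cancel_left]
  constructor <;> linarith [hdrift.1, hdrift.2, hd'.1, hd'.2, hv'.1, hv'.2]

/-- Predicted parameter sets are contained in the prior set. -/
lemma Fpred_subset_OmegaSet {ny m : ℕ} {r0 : Fin ny → ℕ}
    (A0 : ∀ j, Matrix (Fin (r0 j)) (Fin m) ℝ) (b0 : ∀ j, Fin (r0 j) → ℝ)
    (φ : ℕ → Fin m → ℝ) (ytil : ℕ → Fin ny → ℝ)
    (εd εv : Fin ny → ℝ) (θlo θhi : Fin ny → ℕ → ℝ) (M N k t : ℕ) :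
    Fpred A0 b0 φ ytil εd εv θlo θhi M N k t ⊆ OmegaSet A0 b0 := by
  unfold Fpred
  split_ifs
  · exact subset_rfl
  · exact Set.inter_subset_left

/-- The tightening `∑ j, |C l j| * εd j` dominates the contribution of the disturbance. -/
lemma mulVec_le_sum_abs_mul {ny no : ℕ} (C : Matrix (Fin no) (Fin ny) ℝ) {δ εd : Fin ny → ℝ}
    (hδ : ∀ j, |δ j| ≤ εd j) (l : Fin no) : C.mulVec δ l ≤ ∑ j, |C l j| * εd j := by
  rw [mulVec, dotProduct]
  refine Finset.sum_le_sum fun j _ => (le_abs_self _).trans ?_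
  rw [abs_mul]
  exact mul_le_mul_of_nonneg_left (hδ j) (abs_nonneg _)

/-- Theorem 1, recursive feasibility and robust constraint satisfaction.
Under the standing assumptions (bounded disturbance and noise, bounded parameter variation
`H(t+1) − H(t) ∈ D`, `H(t) ∈ Ω`, valid bounds `θ̲, θ̄` on `wᵀx` over `{x : K_j x ≤ l_j}`,
admissible zero input increment), if the FHOCP is feasible at time `t = 1` with previous
input `u₀` and regressor `φ₁`, then there exist a closed-loop input sequence `u` and a
regressor trajectory `φ` with `φ(1) = φ₁`, `u(0) = u₀`, `φ(t+1) = Fφ(t) + Gu(t)` for all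
`t ≥ 1`, such that for every `t ≥ 1`: `u(t)` is the first element of a sequence feasible for
the FHOCP at time `t`, the input constraints hold, and the realized output
`y(t+1) = H(t+1)φ(t+1) + d(t+1)` satisfies the output constraints. -/
theorem stmt_11
    (ny m nu ni nDu no : ℕ) (hny : 0 < ny) (hm : 0 < m) (hnu : 0 < nu)
    (H : ℕ → Matrix (Fin ny) (Fin m) ℝ)
    (d v : ℕ → Fin ny → ℝ)
    (εd εv : Fin ny → ℝ)
    (hεd : ∀ j, 0 < εd j) (hεv : ∀ j, 0 < εv j)
    (hd : ∀ t j, |d t j| ≤ εd j)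
    (hv : ∀ t j, |v t j| ≤ εv j)
    (nΔ : Fin ny → ℕ)
    (K : ∀ j, Matrix (Fin (nΔ j)) (Fin m) ℝ)
    (l : ∀ j, Fin (nΔ j) → ℝ)
    (hD : ∀ t j i, ((K j).mulVec (H (t + 1) j - H t j)) i ≤ l j i)
    -- bounds `θ̲_j(w) ≤ wᵀx ≤ θ̄_j(w)` valid for every regressor value `w` and every
    -- admissible parameter variation `x` (i.e. `K_j x ≤ l_j`)
    (θlo θhi : Fin ny → (Fin m → ℝ) → ℝ)
    (hθ : ∀ j (w x : Fin m → ℝ), (∀ i, ((K j).mulVec x) i ≤ l j i) →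
      θlo j w ≤ w ⬝ᵥ x ∧ w ⬝ᵥ x ≤ θhi j w)
    (r0 : Fin ny → ℕ)
    (A0 : ∀ j, Matrix (Fin (r0 j)) (Fin m) ℝ) (b0 : ∀ j, Fin (r0 j) → ℝ)
    (hΩ : ∀ t, H t ∈ OmegaSet A0 b0)
    (M N : ℕ) (hM : 0 < M) (hMeven : Even M) (hN : 2 ≤ N)
    (Fm : Matrix (Fin m) (Fin m) ℝ) (G : Matrix (Fin m) (Fin nu) ℝ)
    (Cu : Matrix (Fin ni) (Fin nu) ℝ) (CDu : Matrix (Fin nDu) (Fin nu) ℝ)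
    (Cy : Matrix (Fin no) (Fin ny) ℝ)
    (gu : Fin ni → ℝ) (gDu : Fin nDu → ℝ) (gy : Fin no → ℝ)
    (dbar : Fin no → ℝ)
    (hdbar : ∀ l', dbar l' = ∑ j, |Cy l' j| * εd j)
    (hzero : ∀ i, (CDu.mulVec 0) i ≤ gDu i)
    -- previous input and current regressor at time `t = 1`
    (u0 : Fin nu → ℝ) (φ1 : Fin m → ℝ)
    -- the FHOCP is feasible at time `t = 1` (the feasible parameter sets at time `1` only
    -- involve the measurement at time `1`, i.e. the regressor value `φ1`)
    (hfeas : ∃ useq : ℕ → Fin nu → ℝ,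
      Feasible N Fm G Cu CDu Cy gu gDu gy dbar
        (Fpred A0 b0 (fun _ => φ1)
          (fun i => (H i).mulVec φ1 + d i + v i) εd εv
          (fun j _ => θlo j φ1) (fun j _ => θhi j φ1) M N)
        1 u0 φ1 useq) :
    ∃ (u : ℕ → Fin nu → ℝ) (φ : ℕ → Fin m → ℝ),
      φ 1 = φ1 ∧ u 0 = u0 ∧
      (∀ t, 1 ≤ t → φ (t + 1) = Fm.mulVec (φ t) + G.mulVec (u t)) ∧
      (∀ t, 1 ≤ t →
        -- `u t` is the first element of a sequence feasible for the FHOCP at time `t`,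
        -- where the predicted feasible parameter sets are built from the closed-loop data
        (∃ useq : ℕ → Fin nu → ℝ,
          Feasible N Fm G Cu CDu Cy gu gDu gy dbar
            (Fpred A0 b0 φ
              (fun i => (H i).mulVec (φ i) + d i + v i) εd εv
              (fun j i => θlo j (φ i)) (fun j i => θhi j (φ i)) M N)
            t (u (t - 1)) (φ t) useq ∧
          useq t = u t) ∧
        -- input and input-rate constraints
        (∀ i, (Cu.mulVec (u t)) i ≤ gu i) ∧
        (∀ i, (CDu.mulVec (u t - u (t - 1))) i ≤ gDu i) ∧
        -- realized output constraints
        (∀ l', (Cy.mulVec ((H (t + 1)).mulVec (φ (t + 1)) + d (t + 1))) l' ≤ gy l')) := by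
  obtain ⟨useq, hin, hout, hterm⟩ := hfeas
  set u : ℕ → Fin nu → ℝ := fun t => if t = 0 then u0 else useq (min t N) with hu
  set φ : ℕ → Fin m → ℝ := fun t => predReg Fm G φ1 u 1 (t - 1) with hφ
  have hu_pos : ∀ t, 1 ≤ t → u t = useq (min t N) := fun t ht => if_neg (by omega)
  have hφ_hold : ∀ t, φ t = predReg Fm G φ1 useq 1 (min (t - 1) N) := fun t =>
    predReg_hold Fm G φ1 useq u 1 N
      (fun s => by rw [hu_pos _ (by omega), show 1 + N - 1 = N by omega]) hterm (t - 1)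
  have hφ_pred : ∀ t, 1 ≤ t → ∀ s, predReg Fm G (φ t) u t s = φ (t + s) := by
    intro t ht s
    have h := predReg_shift Fm G φ1 u 1 (t - 1) s
    rwa [Nat.add_sub_cancel' ht, ← Nat.sub_add_comm ht] at h
  have hφ_step : ∀ t, 1 ≤ t → φ (t + 1) = Fm.mulVec (φ t) + G.mulVec (u t) := fun t ht =>
    (hφ_pred t ht 1).symm
  have hCu : ∀ t, 1 ≤ t → ∀ i, (Cu.mulVec (u t)) i ≤ gu i := by
    intro t ht
    rw [hu_pos t ht]
    exact (hin (min t N) (by omega) (by omega)).1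
  have hCDu : ∀ t, 1 ≤ t → ∀ i, (CDu.mulVec (u t - u (t - 1))) i ≤ gDu i := by
    intro t ht
    rcases le_or_gt t N with h | h
    · have h1 := (hin t ht (by omega)).2
      rw [hu_pos t ht, min_eq_left h]
      by_cases ht1 : t = 1
      · subst ht1
        simpa [hu] using h1
      · rw [if_neg ht1] at h1
        rwa [hu_pos (t - 1) (by omega), min_eq_left (by omega)]
    · rw [hu_pos t ht, hu_pos (t - 1) (by omega), min_eq_right h.le, min_eq_right (by omega),
        sub_self]
      exact hzero
  have hcons : ∀ k, 2 ≤ k → ∀ Hm ∈ OmegaSet A0 b0,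
      (k ≤ N → k - 1 < M / 2 → Hm ∈ Sset φ (fun i => (H i).mulVec (φ i) + d i + v i) εd εv
        (fun j i => θlo j (φ i)) (fun j i => θhi j (φ i)) 1 k) →
      ∀ l', (Cy.mulVec (Hm.mulVec (φ k))) l' + dbar l' ≤ gy l' := by
    intro k hk Hm hΩm hS
    rw [hφ_hold k]
    rcases le_or_gt k N with h | h
    · rw [min_eq_left (by omega : k - 1 ≤ N)]
      refine hout k hk (by omega) Hm ?_
      rw [Fpred, if_neg (by omega)]
      refine ⟨hΩm, Set.mem_iInter₂.mpr fun i hi => ?_⟩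
      obtain rfl : i = 1 := le_antisymm hi.2.1 hi.1
      exact hS h hi.2.2
    · rw [min_eq_right (by omega : N ≤ k - 1)]
      have h1 := hout (1 + N) (by omega) le_rfl Hm (by rwa [Fpred, if_pos rfl])
      rwa [Nat.add_sub_cancel_left] at h1
  refine ⟨u, φ, rfl, rfl, hφ_step, fun t ht => ⟨⟨u, ⟨?_, ?_, ?_⟩, rfl⟩, hCu t ht, hCDu t ht, ?_⟩⟩
  · intro k hk _
    refine ⟨hCu k (ht.trans hk), ?_⟩
    have hprev : (if k = t then u (t - 1) else u (k - 1)) = u (k - 1) := by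
      split_ifs with h
      · rw [h]
      · rfl
    rw [hprev]
    exact hCDu k (ht.trans hk)
  · intro k hk _ Hm hHm
    rw [hφ_pred t ht, Nat.add_sub_cancel' (by omega : t ≤ k)]
    refine hcons k (by omega) Hm (Fpred_subset_OmegaSet _ _ _ _ _ _ _ _ _ _ _ _ hHm) fun h hw => ?_
    rw [Fpred, if_neg (by omega)] at hHm
    exact Set.mem_iInter₂.mp hHm.2 1 ⟨le_rfl, ht, hw⟩
  · have hsteady : φ (t + N + 1) = φ (t + N) := by
      rw [hφ_hold, hφ_hold, min_eq_right (by omega), min_eq_right (by omega)]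
    have hinput : u (t + N) = u (t + N - 1) := by
      rw [hu_pos _ (by omega), hu_pos _ (by omega), min_eq_right (by omega),
        min_eq_right (by omega)]
    rw [hφ_pred t ht, ← hinput, ← hφ_step _ (by omega), hsteady]
  · intro l'
    have h := hcons (t + 1) (by omega) (H (t + 1)) (hΩ _)
      (fun _ _ => mem_Sset_of_bounds (by omega) (hd 1) (hv 1)
        fun s j => hθ j (φ 1) _ (hD s j)) l'
    have hdist := mulVec_le_sum_abs_mul Cy (hd (t + 1)) l'
    rw [← hdbar] at hdist
    rw [mulVec_add, Pi.add_apply]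
    linarith
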